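/- For C₀ > 0 let A = 1/(1+C₀²) and u_{C₀}(x) = e^{−A} exp(A e^{i C₀ x}) for x ∈ ℝ. Then for every 0 < κ < 1 and every C > 0 there exists C₀' > 0 such that for all C₀ ≥ C₀' there exists n ∈ ℕ₀ with ‖∂ₓⁿ u_{C₀}‖_{L^∞(ℝ)} > (κ C₀ + C)ⁿ · n!/(log(n+e))ⁿ. In other words, for C₀ sufficiently large, u_{C₀} does not satisfy the bound ‖∂ₓⁿ u_{C₀}‖_{L^∞(ℝ)} ≤ (κC₀+C)ⁿ n!/(log(n+e))ⁿ for all n ∈ ℕ₀. -/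

import Mathlib

open Real

/-- `u_{C₀}(x) = e^{-A} exp(A e^{i C₀ x})` with `A = 1/(1+C₀²)`. -/
noncomputable def uEx (C₀ : ℝ) : ℝ → ℂ := fun x =>
  ((Real.exp (-(1 / (1 + C₀ ^ 2))) : ℝ) : ℂ) *
    Complex.exp (((1 / (1 + C₀ ^ 2) : ℝ) : ℂ) *
      Complex.exp (Complex.I * (C₀ : ℂ) * (x : ℂ)))

/-- The Touchard polynomials: `P₀ = 1`, and `Pₙ₊₁` is `X` times the sum of `Pₙ` and its
derivative. -/
noncomputable def touchard : ℕ → Polynomial ℕ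
  | 0 => 1
  | n + 1 => Polynomial.X * (touchard n + Polynomial.derivative (touchard n))

lemma touchard_coeff_succ_succ (n k : ℕ) :
    (touchard (n + 1)).coeff (k + 1) =
      (touchard n).coeff k + (touchard n).coeff (k + 1) * (k + 1) := by
  simp [touchard, Polynomial.coeff_X_mul, Polynomial.coeff_derivative]

lemma pow_le_coeff_touchard (k m : ℕ) : k ^ m ≤ (touchard (k + m)).coeff k := by
  induction k generalizing m with
  | zero =>
    cases m with
    | zero => simp [touchard]
    | succ m => simp
  | succ k ihk =>
    induction m with
    | zero =>
      have h := touchard_coeff_succ_succ k k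
      have hk := ihk 0
      simp only [pow_zero, add_zero] at hk ⊢
      omega
    | succ m ih =>
      have h := touchard_coeff_succ_succ (k + 1 + m) k
      rw [show k + 1 + (m + 1) = k + 1 + m + 1 by ring, h, pow_succ]
      exact (Nat.mul_le_mul_right _ ih).trans (Nat.le_add_left _ _)

lemma iteratedDeriv_uEx (C₀ : ℝ) (n : ℕ) :
    iteratedDeriv n (uEx C₀) = fun x : ℝ =>
      (Complex.I * C₀) ^ n * Polynomial.eval₂ (Nat.castRingHom ℂ)
        (((1 / (1 + C₀ ^ 2) : ℝ) : ℂ) * Complex.exp (Complex.I * C₀ * x)) (touchard n) *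
        uEx C₀ x := by
  set A : ℂ := ((1 / (1 + C₀ ^ 2) : ℝ) : ℂ)
  induction n with
  | zero => ext x; simp [touchard]
  | succ n ih =>
    rw [iteratedDeriv_succ, ih]
    ext x
    have hE : HasDerivAt (fun x : ℝ => A * Complex.exp (Complex.I * C₀ * x))
        (A * (Complex.exp (Complex.I * C₀ * x) * (Complex.I * C₀))) x := by
      have h1 : HasDerivAt (fun x : ℝ => Complex.I * C₀ * (x : ℂ)) (Complex.I * C₀) x := by
        simpa using (Complex.ofRealCLM.hasDerivAt (x := x)).const_mul (Complex.I * (C₀ : ℂ))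
      exact h1.cexp.const_mul A
    have hu : HasDerivAt (uEx C₀)
        (uEx C₀ x * (A * (Complex.exp (Complex.I * C₀ * x) * (Complex.I * C₀)))) x := by
      have := hE.cexp.const_mul ((Real.exp (-(1 / (1 + C₀ ^ 2))) : ℝ) : ℂ)
      rw [← mul_assoc] at this
      exact this
    have hP : HasDerivAt (fun x : ℝ => Polynomial.eval₂ (Nat.castRingHom ℂ)
          (A * Complex.exp (Complex.I * C₀ * x)) (touchard n))
        (Polynomial.eval₂ (Nat.castRingHom ℂ) (A * Complex.exp (Complex.I * C₀ * x))
          (Polynomial.derivative (touchard n)) *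
          (A * (Complex.exp (Complex.I * C₀ * x) * (Complex.I * C₀)))) x := by
      have h := (((touchard n).map (Nat.castRingHom ℂ)).hasDerivAt
        (A * Complex.exp (Complex.I * C₀ * x))).comp x hE
      simpa only [Polynomial.derivative_map, Polynomial.eval_map, Function.comp_def] using h
    refine ((hP.const_mul ((Complex.I * (C₀ : ℂ)) ^ n)).mul hu).deriv.trans ?_
    simp only [touchard, Polynomial.eval₂_mul, Polynomial.eval₂_add, Polynomial.eval₂_X]
    ring

lemma norm_iteratedDeriv_uEx_zero {C₀ : ℝ} (hC₀ : 0 < C₀) (k m : ℕ) :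
    C₀ ^ (k + m) * ((1 / (1 + C₀ ^ 2)) ^ k * (k : ℝ) ^ m) ≤
      ‖iteratedDeriv (k + m) (uEx C₀) 0‖ := by
  have hu : uEx C₀ 0 = 1 := by
    simp only [uEx, Complex.ofReal_zero, mul_zero, Complex.exp_zero, mul_one]
    rw [← Complex.ofReal_exp, ← Complex.ofReal_mul, ← Real.exp_add]
    simp
  set A : ℝ := 1 / (1 + C₀ ^ 2) with hA
  have hA0 : 0 < A := by positivity
  have hev : Polynomial.eval₂ (Nat.castRingHom ℂ) (A : ℂ) (touchard (k + m)) =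
      ((Polynomial.eval₂ (Nat.castRingHom ℝ) A (touchard (k + m)) : ℝ) : ℂ) := by
    simp [Polynomial.eval₂_eq_sum_range]
  have hterm : A ^ k * (k : ℝ) ^ m ≤
      Polynomial.eval₂ (Nat.castRingHom ℝ) A (touchard (k + m)) := by
    have hc : (k : ℝ) ^ m ≤ ((touchard (k + m)).coeff k : ℝ) := by
      exact_mod_cast pow_le_coeff_touchard k m
    rw [Polynomial.eval₂_eq_sum, Polynomial.sum_def]
    by_cases hk : k ∈ (touchard (k + m)).support
    · calc A ^ k * (k : ℝ) ^ m ≤ ((touchard (k + m)).coeff k : ℝ) * A ^ k := by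
            rw [mul_comm]; gcongr
        _ ≤ _ := Finset.single_le_sum
            (f := fun j => ((touchard (k + m)).coeff j : ℝ) * A ^ j)
            (fun j _ => by positivity) hk
    · rw [Polynomial.notMem_support_iff.mp hk, Nat.cast_zero] at hc
      calc A ^ k * (k : ℝ) ^ m ≤ 0 := mul_nonpos_of_nonneg_of_nonpos (by positivity) hc
        _ ≤ _ := Finset.sum_nonneg fun j _ => by simp only [Nat.coe_castRingHom]; positivity
  rw [iteratedDeriv_uEx]
  simp only [Complex.ofReal_zero, mul_zero, Complex.exp_zero, mul_one, hu]
  rw [← hA, hev, norm_mul, norm_pow, norm_mul, Complex.norm_I, one_mul, Complex.norm_real,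
    Complex.norm_real, Real.norm_of_nonneg hC₀.le,
    Real.norm_of_nonneg ((by positivity : (0 : ℝ) ≤ A ^ k * (k : ℝ) ^ m).trans hterm)]
  gcongr

lemma factorial_le_mul_exp {n : ℕ} (hn : 1 ≤ n) :
    (n.factorial : ℝ) ≤ n * (n : ℝ) ^ n * Real.exp (1 - n) := by
  induction n, hn using Nat.le_induction with
  | base => simp
  | succ n hn ih =>
    have hn0 : (0 : ℝ) < n := by exact_mod_cast hn
    have hlog : Real.exp 1 * (n : ℝ) ^ (n + 1) ≤ ((n : ℝ) + 1) ^ (n + 1) := by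
      have h1 := Real.one_sub_inv_le_log_of_pos (show 0 < ((n : ℝ) + 1) / n by positivity)
      have h2 : (1 : ℝ) ≤ (n + 1 : ℕ) * Real.log (((n : ℝ) + 1) / n) := by
        calc (1 : ℝ) = (n + 1 : ℕ) * (1 - (((n : ℝ) + 1) / n)⁻¹) := by
              push_cast; field_simp; ring
          _ ≤ _ := by gcongr
      rw [← Real.log_pow] at h2
      have h3 := (Real.le_log_iff_exp_le (by positivity)).mp h2
      rwa [div_pow, le_div_iff₀ (by positivity)] at h3
    have he : Real.exp (1 - n) = Real.exp 1 * Real.exp (1 - ((n + 1 : ℕ) : ℝ)) := by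
      rw [← Real.exp_add]; congr 1; push_cast; ring
    rw [Nat.factorial_succ, Nat.cast_mul]
    calc ((n + 1 : ℕ) : ℝ) * n.factorial
        ≤ ((n + 1 : ℕ) : ℝ) * (n * (n : ℝ) ^ n * Real.exp (1 - n)) := by gcongr
      _ = ((n + 1 : ℕ) : ℝ) * (Real.exp 1 * (n : ℝ) ^ (n + 1)) *
          Real.exp (1 - ((n + 1 : ℕ) : ℝ)) := by rw [he]; ring
      _ ≤ ((n + 1 : ℕ) : ℝ) * ((n : ℝ) + 1) ^ (n + 1) *
          Real.exp (1 - ((n + 1 : ℕ) : ℝ)) := by gcongr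
      _ = _ := by push_cast; ring

lemma exists_nat_log_lt {δ a : ℝ} (hδ : 0 < δ) (ha : 0 ≤ a) :
    ∃ n : ℕ, 1 ≤ n ∧
      1 + 2 * Real.log n + (n / Real.log ((n : ℝ) + Real.exp 1) + 1) * a < n * δ := by
  have hnat := tendsto_natCast_atTop_atTop (R := ℝ)
  have hlog : ∀ᶠ n : ℕ in Filter.atTop, Real.log n ≤ δ / 8 * n := by
    have h := hnat.eventually (Real.isLittleO_log_id_atTop.bound (show 0 < δ / 8 by positivity))
    filter_upwards [h] with n hn
    have := (le_abs_self _).trans hn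
    simpa using this
  have hL : ∀ᶠ n : ℕ in Filter.atTop, 4 * a / δ ≤ Real.log ((n : ℝ) + Real.exp 1) :=
    (Real.tendsto_log_atTop.comp
      (Filter.tendsto_atTop_add_const_right _ (Real.exp 1) hnat)).eventually_ge_atTop _
  obtain ⟨n, h1, h2, h3, h4⟩ := (hlog.and (hL.and
    ((hnat.eventually_ge_atTop (4 * (1 + a) / δ)).and (Filter.eventually_ge_atTop 1)))).exists
  refine ⟨n, h4, ?_⟩
  have hn0 : (0 : ℝ) < n := by exact_mod_cast h4
  have hL1 : 1 < Real.log ((n : ℝ) + Real.exp 1) := by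
    rw [Real.lt_log_iff_exp_lt (by positivity)]; linarith
  rw [div_le_iff₀ hδ] at h2 h3
  have h5 : n / Real.log ((n : ℝ) + Real.exp 1) * a ≤ n * δ / 4 := by
    rw [div_mul_eq_mul_div, div_le_iff₀ (by linarith)]
    nlinarith
  nlinarith [mul_pos hn0 hδ]

lemma exists_pow_mul_factorial_div_log_lt {q A : ℝ} (hq0 : 0 < q) (hq1 : q < 1) (hA0 : 0 < A)
    (hA1 : A ≤ 1) :
    ∃ k m : ℕ, q ^ (k + m) * ((k + m).factorial : ℝ) /
      Real.log (((k + m : ℕ) : ℝ) + Real.exp 1) ^ (k + m) < A ^ k * (k : ℝ) ^ m := by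
  obtain ⟨n, hn1, hn⟩ := exists_nat_log_lt (neg_pos.mpr (Real.log_neg hq0 hq1))
    (neg_nonneg.mpr (Real.log_nonpos hA0.le hA1))
  set L := Real.log ((n : ℝ) + Real.exp 1) with hLdef
  have hn0 : (0 : ℝ) < n := by exact_mod_cast hn1
  have hL1 : 1 < L := by
    rw [hLdef, Real.lt_log_iff_exp_lt (by positivity)]; linarith
  have hL0 : 0 < L := by linarith
  have hlogL : Real.log n ≤ L := Real.log_le_log hn0 (by linarith [Real.exp_pos 1])
  have hkn : ⌈(n : ℝ) / L⌉₊ ≤ n := Nat.ceil_le.mpr (div_le_self hn0.le hL1.le)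
  have hk_ge := Nat.le_ceil ((n : ℝ) / L)
  have hk_lt := Nat.ceil_lt_add_one (show 0 ≤ (n : ℝ) / L by positivity)
  set k := ⌈(n : ℝ) / L⌉₊
  obtain ⟨m, hm⟩ := Nat.exists_eq_add_of_le hkn
  refine ⟨k, m, ?_⟩
  rw [← hm, ← hLdef, div_lt_iff₀ (by positivity)]
  have hlogn : 0 ≤ Real.log n := Real.log_nonneg (by exact_mod_cast hn1)
  have hnk : (n : ℝ) ^ k ≤ n * Real.exp n := by
    rw [← Real.exp_log (pow_pos hn0 k), Real.log_pow]
    have h : (n : ℝ) * Real.exp n = Real.exp (Real.log n + n) := by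
      rw [Real.exp_add, Real.exp_log hn0]
    rw [h, Real.exp_le_exp]
    calc (k : ℝ) * Real.log n ≤ (n / L + 1) * Real.log n := by gcongr
      _ = Real.log n + n * (Real.log n / L) := by ring
      _ ≤ Real.log n + n * 1 := by gcongr; exact (div_le_one hL0).mpr hlogL
      _ = _ := by ring
  have hAk : Real.exp ((n / L + 1) * Real.log A) ≤ A ^ k := by
    rw [← Real.exp_log (pow_pos hA0 k), Real.log_pow]
    exact Real.exp_le_exp.mpr (mul_le_mul_of_nonpos_right hk_lt.le (Real.log_nonpos hA0.le hA1))
  have hkk : (k : ℝ) ^ n ≤ (k : ℝ) ^ m * (n : ℝ) ^ k := by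
    rw [show (k : ℝ) ^ n = (k : ℝ) ^ m * (k : ℝ) ^ k by rw [← pow_add, add_comm, ← hm]]
    gcongr
  have hnL : (n : ℝ) ^ n ≤ (k : ℝ) ^ n * L ^ n := by
    rw [← mul_pow]
    gcongr
    exact (div_le_iff₀ hL0).mp hk_ge
  refine lt_of_mul_lt_mul_right (a := (n : ℝ) ^ k) ?_ (by positivity)
  calc q ^ n * n.factorial * (n : ℝ) ^ k
      ≤ q ^ n * (n * (n : ℝ) ^ n * Real.exp (1 - n)) * (n * Real.exp n) := by
        gcongr; exact factorial_le_mul_exp hn1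
    _ = Real.exp (1 + 2 * Real.log n + n * Real.log q) * (n : ℝ) ^ n := by
        rw [show 1 + 2 * Real.log n + n * Real.log q =
          (1 - n) + n + Real.log n + Real.log n + n * Real.log q by ring, Real.exp_add,
          Real.exp_add, Real.exp_add, Real.exp_add, Real.exp_log hn0, ← Real.log_pow,
          Real.exp_log (pow_pos hq0 n)]
        ring
    _ < Real.exp ((n / L + 1) * Real.log A) * (n : ℝ) ^ n := by
        gcongr
        linarith
    _ ≤ A ^ k * ((k : ℝ) ^ n * L ^ n) := by gcongr
    _ ≤ A ^ k * ((k : ℝ) ^ m * (n : ℝ) ^ k * L ^ n) := by gcongr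
    _ = A ^ k * (k : ℝ) ^ m * L ^ n * (n : ℝ) ^ k := by ring

/-- **Failure of the bound with `κ < 1`** (Proposition 2.6(2)): for every
`0 < κ < 1` and `C > 0` there exists `C₀' > 0` such that for all `C₀ ≥ C₀'` the
function `u_{C₀} = e^{-A} exp(A e^{iC₀x})` does not satisfy
`‖∂ₓⁿ u_{C₀}‖_{L^∞(ℝ)} ≤ (κC₀+C)ⁿ n!/(log(n+e))ⁿ` for all `n`; that is, there
exist `n ∈ ℕ₀` and `x ∈ ℝ` with `|∂ₓⁿ u_{C₀}(x)| > (κC₀+C)ⁿ n!/(log(n+e))ⁿ`. -/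
theorem sharp_example_kappa_lt_one (κ C : ℝ) (hκ0 : 0 < κ) (hκ1 : κ < 1)
    (hC : 0 < C) :
    ∃ C₀' : ℝ, 0 < C₀' ∧ ∀ C₀ : ℝ, C₀' ≤ C₀ →
      ∃ (n : ℕ) (x : ℝ),
        (κ * C₀ + C) ^ n * (Nat.factorial n : ℝ) /
            Real.log ((n : ℝ) + Real.exp 1) ^ n <
          ‖iteratedDeriv n (uEx C₀) x‖ := by
  refine ⟨2 * C / (1 - κ), div_pos (by linarith) (by linarith), fun C₀ hC₀ => ?_⟩
  rw [div_le_iff₀ (by linarith)] at hC₀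
  have hC₀pos : 0 < C₀ := by
    by_contra! h
    nlinarith
  have hA1 : 1 / (1 + C₀ ^ 2) ≤ 1 := (div_le_one (by positivity)).mpr (by nlinarith)
  obtain ⟨k, m, hkm⟩ := exists_pow_mul_factorial_div_log_lt (q := (κ + 1) / 2)
    (A := 1 / (1 + C₀ ^ 2)) (by linarith) (by linarith) (by positivity) hA1
  refine ⟨k + m, 0, lt_of_lt_of_le ?_ (norm_iteratedDeriv_uEx_zero hC₀pos k m)⟩
  have hlog : 0 ≤ Real.log (((k + m : ℕ) : ℝ) + Real.exp 1) :=
    Real.log_nonneg (by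
      linarith [Real.one_le_exp zero_le_one, (Nat.cast_nonneg (k + m) : (0 : ℝ) ≤ _)])
  calc _ ≤ (C₀ * ((κ + 1) / 2)) ^ (k + m) * ((k + m).factorial : ℝ) /
        Real.log (((k + m : ℕ) : ℝ) + Real.exp 1) ^ (k + m) := by
        gcongr
        linarith
    _ = C₀ ^ (k + m) * (((κ + 1) / 2) ^ (k + m) * ((k + m).factorial : ℝ) /
        Real.log (((k + m : ℕ) : ℝ) + Real.exp 1) ^ (k + m)) := by
        rw [mul_pow]; ring
    _ < _ := by gcongr
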